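/- arXiv:1211.5689 — 2 statements merged into one kernel-verified Lean document; each statement's English description precedes it below -/
import Mathlib

section
/- Observation 1: Let G be a connected finite simple graph with at least one edge, and let P be the transition matrix of simple random walk on G. Then G satisfies condition (1), namely (P^n) x x = (P^n) y y for every natural number n and all vertices x, y, if and only if G is walk-regular, i.e. for every natural number n the number of closed walks of length n at x is the same for all vertices x. -/
open Polynomial in
theorem aux_regular {V : Type*} [Fintype V] [DecidableEq V]
    (G : SimpleGraph V) [DecidableRel G.Adj]
    (hconn : G.Connected)
    (P : Matrix V V ℝ)
    (hP : P = Matrix.of fun x y : V => if G.Adj x y then ((G.degree x : ℝ))⁻¹ else 0)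
    (hd : ∀ x, (G.degree x : ℝ) ≠ 0)
    (h : ∀ (n : ℕ) (x y : V), (P ^ n) x x = (P ^ n) y y) (x y : V) :
    G.degree x = G.degree y := by
  have hDP : G.degMatrix ℝ * P = G.adjMatrix ℝ := by
    ext a b
    rw [SimpleGraph.degMatrix, Matrix.diagonal_mul, hP]
    by_cases hab : G.Adj a b <;> simp [hab, hd a]
  have hsymD : (G.degMatrix ℝ).transpose = G.degMatrix ℝ := by
    simp [SimpleGraph.degMatrix]
  have hsc : SemiconjBy (G.degMatrix ℝ) P P.transpose := by
    have := congrArg Matrix.transpose hDP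
    rw [Matrix.transpose_mul, hsymD, SimpleGraph.transpose_adjMatrix] at this
    exact hDP.trans this.symm
  have hbal : ∀ q : ℝ[X], (G.degMatrix ℝ * aeval P q).transpose = G.degMatrix ℝ * aeval P q := by
    intro q
    induction q using Polynomial.induction_on' with
    | add p q hp hq => simp only [map_add, mul_add, Matrix.transpose_add, hp, hq]
    | monomial n a =>
      have := (hsc.pow_right n).eq
      rw [aeval_monomial, ← Algebra.smul_def, mul_smul_comm, Matrix.transpose_smul,
        Matrix.transpose_mul, hsymD, Matrix.transpose_pow, this]
  have hdiag : ∀ (q : ℝ[X]) (x y : V), (aeval P q) x x = (aeval P q) y y := by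
    intro q
    induction q using Polynomial.induction_on' with
    | add p q hp hq =>
      intro x y
      simp only [map_add, Matrix.add_apply, hp x y, hq x y]
    | monomial n a =>
      intro x y
      rw [aeval_monomial, ← Algebra.smul_def, Matrix.smul_apply, Matrix.smul_apply, h n x y]
  have hP1 : P.mulVec 1 = 1 := by
    ext a
    have : (G.degMatrix ℝ).mulVec (P.mulVec 1) a = (G.degree a : ℝ) := by
      rw [Matrix.mulVec_mulVec, hDP]
      simp [SimpleGraph.adjMatrix_mulVec_apply]
    rw [SimpleGraph.degMatrix, Matrix.mulVec_diagonal] at this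
    have h2 := hd a
    simpa [h2] using this
  have hq1 : ∀ q : ℝ[X], (aeval P q).mulVec 1 = q.eval 1 • (1 : V → ℝ) := by
    intro q
    induction q using Polynomial.induction_on' with
    | add p q hp hq => simp only [map_add, Matrix.add_mulVec, hp, hq, eval_add, add_smul]
    | monomial n a =>
      have hn : (P ^ n).mulVec 1 = 1 := by
        induction n with
        | zero => simp
        | succ n ih => rw [pow_succ, ← Matrix.mulVec_mulVec, hP1, ih]
      rw [aeval_monomial, ← Algebra.smul_def, Matrix.smul_mulVec, hn]
      simp
  have hint : IsIntegral ℝ P := Algebra.IsIntegral.isIntegral P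
  have hroot : (minpoly ℝ P).IsRoot 1 := by
    have := congrFun (hq1 (minpoly ℝ P)) x
    rw [minpoly.aeval] at this
    simpa using this.symm
  obtain ⟨r, hr⟩ := dvd_iff_isRoot.mpr hroot
  have hm0 := minpoly.ne_zero hint
  have hr0 : r ≠ 0 := by
    rintro rfl
    exact hm0 (by simpa using hr)
  have hrP : aeval P r ≠ 0 := by
    intro h0
    have hle := minpoly.degree_le_of_ne_zero ℝ P hr0 h0
    rw [hr, degree_mul, degree_X_sub_C, degree_eq_natDegree hr0] at hle
    have : 1 + r.natDegree ≤ r.natDegree := by exact_mod_cast hle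
    omega
  have hann : (P - 1) * aeval P r = 0 := by
    have := minpoly.aeval ℝ P
    rw [hr] at this
    simpa using this
  have hL : G.lapMatrix ℝ * aeval P r = 0 := by
    have : G.lapMatrix ℝ = -(G.degMatrix ℝ * (P - 1)) := by
      rw [mul_sub, hDP, SimpleGraph.lapMatrix]; simp
    rw [this, neg_mul, mul_assoc, hann]; simp
  have hcol : ∀ a b c, (aeval P r) a c = (aeval P r) b c := by
    intro a b c
    have h1 : (G.lapMatrix ℝ).mulVec (fun i => (aeval P r) i c) = 0 := by
      ext i
      exact congrFun (congrFun hL i) c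
    exact (SimpleGraph.lapMatrix_mulVec_eq_zero_iff_forall_reachable G).mp h1 a b
      (hconn.preconnected a b)
  have hconst : ∀ a b, (aeval P r) a b = (aeval P r) x x := by
    intro a b
    rw [hcol a b b, hdiag r b x]
  have hne : (aeval P r) x x ≠ 0 := by
    intro h0
    apply hrP
    ext a b
    rw [hconst, h0]; rfl
  have hb := congrFun (congrFun (hbal r) y) x
  rw [Matrix.transpose_apply, SimpleGraph.degMatrix, Matrix.diagonal_mul, Matrix.diagonal_mul,
    hconst x y, hconst y x] at hb
  exact_mod_cast mul_right_cancel₀ hne hb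

/-- Observation 1: a connected finite simple graph with at least one edge satisfies
condition (1) (the `n`-step return probability of simple random walk is independent of
the starting vertex, for all `n`) if and only if it is walk-regular. -/
theorem return_prob_constant_iff_walk_regular {V : Type*} [Fintype V] [DecidableEq V]
    (G : SimpleGraph V) [DecidableRel G.Adj]
    (hconn : G.Connected) (hedge : G.edgeSet.Nonempty)
    (P : Matrix V V ℝ)
    (hP : P = Matrix.of fun x y : V => if G.Adj x y then ((G.degree x : ℝ))⁻¹ else 0) :
    (∀ (n : ℕ) (x y : V), (P ^ n) x x = (P ^ n) y y) ↔
    (∀ (n : ℕ) (x y : V),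
      Fintype.card {p : G.Walk x x // p.length = n} =
      Fintype.card {p : G.Walk y y // p.length = n}) := by
  have hcard : ∀ (n : ℕ) (x : V), (Fintype.card {p : G.Walk x x // p.length = n} : ℝ) =
      (G.adjMatrix ℝ ^ n) x x := by
    intro n x
    rw [SimpleGraph.adjMatrix_pow_apply_eq_card_walk]
    exact congrArg _ (Fintype.card_congr (Equiv.refl _))
  have hd : ∀ x, (G.degree x : ℝ) ≠ 0 := by
    intro x
    obtain ⟨e, he⟩ := hedge
    induction e with
    | _ a b =>
      have hab : G.Adj a b := he
      haveI : Nontrivial V := ⟨a, b, hab.ne⟩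
      exact_mod_cast (hconn.preconnected.degree_pos_of_nontrivial x).ne'
  have hreg : (∀ x y, G.degree x = G.degree y) → ∀ (n : ℕ) (x y : V),
      (G.adjMatrix ℝ ^ n) y y = (G.degree x : ℝ) ^ n * (P ^ n) y y := by
    intro hxy n x y
    have : G.adjMatrix ℝ = (G.degree x : ℝ) • P := by
      ext a b
      rw [hP]
      by_cases hab : G.Adj a b <;> simp [hab, hxy a x, hd x]
    rw [this, smul_pow]; rfl
  constructor
  · intro h n x y
    have hxy := aux_regular G hconn P hP hd h
    have : (Fintype.card {p : G.Walk x x // p.length = n} : ℝ) =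
      Fintype.card {p : G.Walk y y // p.length = n} := by
      rw [hcard, hcard, hreg hxy n x x, hreg hxy n x y, h n x y]
    exact_mod_cast this
  · intro h n x y
    have hA : ∀ (n : ℕ) (x y : V), (G.adjMatrix ℝ ^ n) x x = (G.adjMatrix ℝ ^ n) y y := by
      intro n x y
      rw [← hcard, ← hcard, h n x y]
    have hxy : ∀ x y, G.degree x = G.degree y := by
      intro x y
      have := hA 2 x y
      rw [pow_two, SimpleGraph.adjMatrix_mul_self_apply_self,
        SimpleGraph.adjMatrix_mul_self_apply_self] at this
      exact_mod_cast this
    have := hA n x y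
    rw [hreg hxy n x x, hreg hxy n x y] at this
    exact mul_left_cancel₀ (pow_ne_zero n (hd x)) this
end

section
/- Let G be a connected finite simple graph with at least one edge, and let P be the transition matrix of simple random walk on G. If G satisfies condition (1), namely (P^n) x x = (P^n) y y for every natural number n and all vertices x, y, then G is regular: all vertices of G have the same degree. -/
open Polynomial in
/-- If a connected finite simple graph with at least one edge satisfies condition (1)
(the `n`-step return probability of simple random walk is independent of the starting
vertex, for all `n`), then the graph is regular. -/
theorem return_prob_constant_implies_regular {V : Type*} [Fintype V] [DecidableEq V]
    (G : SimpleGraph V) [DecidableRel G.Adj]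
    (hconn : G.Connected) (hedge : G.edgeSet.Nonempty)
    (P : Matrix V V ℝ)
    (hP : P = Matrix.of fun x y : V => if G.Adj x y then ((G.degree x : ℝ))⁻¹ else 0)
    (hcond : ∀ (n : ℕ) (x y : V), (P ^ n) x x = (P ^ n) y y) :
    ∃ k : ℕ, ∀ v : V, G.degree v = k := by
  classical
  have hnt : Nontrivial V := by
    obtain ⟨e, he⟩ := hedge
    induction e using Sym2.ind with
    | _ a b => exact ⟨a, b, (G.mem_edgeSet.1 he).ne⟩
  have hpos : ∀ v, (G.degree v : ℝ) ≠ 0 := fun v => by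
    exact_mod_cast (hconn.preconnected.degree_pos_of_nontrivial v).ne'
  have hconst : ∀ h : V → ℝ, (∀ v, (G.degree v : ℝ) * h v = ∑ u ∈ G.neighborFinset v, h u) →
      ∀ i j, h i = h j := by
    intro h hh i j
    refine (G.lapMatrix_mulVec_eq_zero_iff_forall_reachable).1 ?_ i j (hconn.preconnected i j)
    ext v
    rw [SimpleGraph.lapMatrix_mulVec_apply, hh v]
    simp
  have hsum : ∀ (v : V) (h : V → ℝ), ∑ u ∈ G.neighborFinset v, h u
      = ∑ u, if G.Adj v u then h u else 0 := by
    intro v h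
    rw [← Finset.sum_filter, SimpleGraph.neighborFinset_eq_filter]
  have hPapp : ∀ x y, P x y = if G.Adj x y then ((G.degree x : ℝ))⁻¹ else 0 := by
    intro x y; rw [hP]; rfl
  have hleft : ∀ (v : V) (h : V → ℝ), (G.degree v : ℝ) * ∑ u, P v u * h u
      = ∑ u ∈ G.neighborFinset v, h u := by
    intro v h
    rw [hsum, Finset.mul_sum]
    refine Finset.sum_congr rfl fun u _ => ?_
    rw [hPapp]
    have := hpos v
    split_ifs
    · field_simp
    · simp
  have hP1 : P.mulVec 1 = 1 := by
    ext v
    have := hleft v 1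
    simp only [Pi.one_apply, mul_one, Finset.sum_const, SimpleGraph.card_neighborFinset_eq_degree,
      nsmul_eq_mul] at this
    have h2 : ∑ u, P v u = 1 := by
      apply mul_left_cancel₀ (hpos v); rw [this, mul_one]
    simpa [Matrix.mulVec, dotProduct] using h2
  have hPn : ∀ n, (P ^ n).mulVec 1 = 1 := by
    intro n
    induction n with
    | zero => simp
    | succ n ih => rw [pow_succ, ← Matrix.mulVec_mulVec, hP1, ih]
  have heval : ∀ p : ℝ[X], (aeval P p).mulVec 1 = p.eval 1 • (1 : V → ℝ) := by
    intro p
    rw [aeval_eq_sum_range, eval_eq_sum_range, Matrix.sum_mulVec, Finset.sum_smul]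
    refine Finset.sum_congr rfl fun i _ => ?_
    rw [Matrix.smul_mulVec, hPn]; simp
  obtain ⟨x0⟩ := hconn.nonempty
  have hroot : (minpoly ℝ P).IsRoot 1 := by
    have := congrFun (heval (minpoly ℝ P)) x0
    simpa using this.symm
  obtain ⟨q, hq⟩ := dvd_iff_isRoot.2 hroot
  have hm0 : minpoly ℝ P ≠ 0 := minpoly.ne_zero (Matrix.isIntegral P)
  have hq0 : q ≠ 0 := by rintro rfl; simp at hq; exact hm0 hq
  have hQ0 : aeval P q ≠ 0 := by
    intro h
    have h1 := natDegree_le_of_dvd (minpoly.dvd ℝ P h) hq0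
    rw [hq, natDegree_mul (X_sub_C_ne_zero 1) hq0, natDegree_X_sub_C] at h1
    omega
  have hPQ : P * aeval P q = aeval P q := by
    have := minpoly.aeval ℝ P
    rw [hq] at this
    simpa [sub_mul, sub_eq_zero] using this
  have hQP : aeval P q * P = aeval P q := by
    have := minpoly.aeval ℝ P
    rw [hq, mul_comm] at this
    simpa [mul_sub, sub_eq_zero] using this
  have hdiag : ∀ x y, aeval P q x x = aeval P q y y := by
    intro x y
    rw [aeval_eq_sum_range, Matrix.sum_apply, Matrix.sum_apply]
    refine Finset.sum_congr rfl fun i _ => ?_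
    rw [Matrix.smul_apply, Matrix.smul_apply, hcond i x y]
  generalize aeval P q = Q at *
  have hcol : ∀ y x x', Q x y = Q x' y := by
    intro y
    refine hconst (fun x => Q x y) fun v => ?_
    rw [← hleft, ← Matrix.mul_apply, hPQ]
  have hrow : ∀ x y y', Q x y * (G.degree y : ℝ)⁻¹ = Q x y' * (G.degree y' : ℝ)⁻¹ := by
    intro x
    refine hconst (fun y => Q x y * (G.degree y : ℝ)⁻¹) fun v => ?_
    have h1 : (G.degree v : ℝ) * (Q x v * (G.degree v : ℝ)⁻¹) = Q x v := by
      have := hpos v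
      field_simp
    rw [h1, hsum]
    conv_lhs => rw [← hQP, Matrix.mul_apply]
    refine Finset.sum_congr rfl fun u _ => ?_
    rw [hPapp]
    by_cases h : G.Adj v u
    · rw [if_pos h, if_pos h.symm]
    · rw [if_neg h, if_neg fun h' => h h'.symm, mul_zero]
  have hne : ∀ x y, Q x y ≠ 0 := by
    intro x y h
    apply hQ0
    ext a b
    have h1 := hrow x b y
    rw [h, zero_mul] at h1
    have h2 := (mul_eq_zero.1 h1).resolve_right (inv_ne_zero (hpos b))
    rw [hcol b a x, h2]; rfl
  refine ⟨G.degree x0, fun v => ?_⟩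
  have h1 := hrow v v x0
  rw [hcol x0 v x0, hdiag v x0] at h1
  have h2 := inv_injective (mul_left_cancel₀ (hne _ _) h1)
  exact_mod_cast h2
end
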